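/- Every demicap in (ZMod 3)^4 is contained in exactly 6 maximal (20-point) caps. -/

import Mathlib

abbrev V4 := Fin 4 → ZMod 3

def IsCap (C : Set V4) : Prop :=
  ∀ a ∈ C, ∀ b ∈ C, ∀ c ∈ C, a ≠ b → a ≠ c → b ≠ c → a + b + c ≠ 0

def IsDemicap (a : V4) (D : Finset V4) : Prop :=
  D.card = 10 ∧ IsCap (↑D : Set V4) ∧
  ∃ d d' : Fin 5 → V4,
    (∀ i, a + d i + d' i = 0) ∧
    D = Finset.univ.image d ∪ Finset.univ.image d' ∧
    ¬ ∃ s : Finset (Fin 5), s.card = 4 ∧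
      ∃ W : Submodule (ZMod 3) V4, Module.finrank (ZMod 3) W = 3 ∧
        ∀ i ∈ s, d i - a ∈ W

/-- The canonical demicap, anchored at the origin. -/
def demiList : List V4 :=
  [![1,0,0,0], ![0,1,0,0], ![0,0,1,0], ![0,0,0,1], ![1,1,1,1], ![2,0,0,0], ![0,2,0,0], ![0,0,2,0], ![0,0,0,2], ![2,2,2,2]]

/-- The points that lie on no line through two points of the canonical demicap. -/
def restList : List V4 :=
  [![0,1,1,2], ![0,1,2,1], ![0,1,2,2], ![0,2,1,1], ![0,2,1,2], ![0,2,2,1], ![1,0,1,2], ![1,0,2,1], ![1,0,2,2], ![1,1,0,2], ![1,1,2,0], ![1,1,2,2], ![1,2,0,1], ![1,2,0,2], ![1,2,1,0], ![1,2,1,2], ![1,2,2,0], ![1,2,2,1], ![2,0,1,1], ![2,0,1,2], ![2,0,2,1], ![2,1,0,1], ![2,1,0,2], ![2,1,1,0], ![2,1,1,2], ![2,1,2,0], ![2,1,2,1], ![2,2,0,1], ![2,2,1,0], ![2,2,1,1]]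

/-- Triples of points of `restList`, any two of which are collinear with a point of
the canonical demicap; every point of `restList` is in exactly two of them. -/
def triList : List (List V4) :=
  [[![0,1,1,2], ![0,1,2,1], ![0,2,1,1]],
   [![0,1,1,2], ![1,2,2,1], ![2,1,1,0]],
   [![0,1,2,1], ![1,2,1,2], ![2,1,0,1]],
   [![0,2,1,1], ![1,1,2,2], ![2,0,1,1]],
   [![1,0,1,2], ![1,0,2,1], ![2,0,1,1]],
   [![1,1,0,2], ![1,2,0,1], ![2,1,0,1]],
   [![1,1,2,0], ![1,2,1,0], ![2,1,1,0]],
   [![1,0,1,2], ![1,2,1,0], ![2,1,2,1]],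
   [![1,0,2,1], ![1,2,0,1], ![2,1,1,2]],
   [![1,1,0,2], ![1,1,2,0], ![2,2,1,1]],
   [![0,1,2,2], ![0,2,1,2], ![0,2,2,1]],
   [![0,1,2,2], ![1,0,2,2], ![2,2,1,1]],
   [![0,2,1,2], ![1,2,0,2], ![2,1,2,1]],
   [![0,2,2,1], ![1,2,2,0], ![2,1,1,2]],
   [![1,0,2,2], ![2,0,1,2], ![2,0,2,1]],
   [![1,1,2,2], ![2,2,0,1], ![2,2,1,0]],
   [![1,2,0,2], ![2,1,0,2], ![2,2,0,1]],
   [![1,2,1,2], ![2,0,2,1], ![2,1,2,0]],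
   [![1,2,2,0], ![2,1,2,0], ![2,2,1,0]],
   [![1,2,2,1], ![2,0,1,2], ![2,1,0,2]]]

/-- Inserting `x` into `cur` creates no line. -/
def okIns (x : V4) (cur : List V4) : Bool :=
  cur.all fun y => decide (-(x + y) ∉ cur)

/-- Extend `cur` by one point from each of the given triples, in all cap-preserving ways. -/
def srch : List (List V4) → List V4 → List (List V4)
  | [], cur => [cur]
  | T :: Ts, cur => T.flatMap fun x =>
      if x ∈ cur then srch Ts cur
      else if okIns x cur then srch Ts (x :: cur) else []

lemma v4_three (x : V4) : x + x + x = 0 := by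
  ext i
  have : ∀ t : ZMod 3, t + t + t = 0 := by decide
  exact this (x i)

lemma srch_complete (C : Set V4) (hC : IsCap C) (Ts : List (List V4)) :
    ∀ cur : List V4, (∀ y ∈ cur, y ∈ C) → (∀ T ∈ Ts, ∃ x ∈ T, x ∈ C) →
      ∃ r ∈ srch Ts cur, ∀ y ∈ r, y ∈ C := by
  induction Ts with
  | nil => intro cur h _; exact ⟨cur, by simp [srch], h⟩
  | cons T Ts ih =>
    intro cur h hT
    obtain ⟨x, hxT, hxC⟩ := hT T (by simp)
    have hT' : ∀ T ∈ Ts, ∃ x ∈ T, x ∈ C := fun T hh => hT T (by simp [hh])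
    by_cases hx : x ∈ cur
    · obtain ⟨r, hr, hr'⟩ := ih cur h hT'
      refine ⟨r, ?_, hr'⟩
      simp only [srch, List.mem_flatMap]
      exact ⟨x, hxT, by simpa [hx] using hr⟩
    · have hok : okIns x cur = true := by
        simp only [okIns, List.all_eq_true, decide_eq_true_eq]
        intro y hy hz
        have hxy : x ≠ y := fun e => hx (e ▸ hy)
        refine hC x hxC y (h y hy) _ (h _ hz) hxy (fun e => hx (e ▸ hz)) ?_ (by abel)
        intro e
        apply hxy
        have h3 := v4_three y
        have : x + y + y = 0 := by nth_rewrite 2 [e]; abel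
        have h4 : x + y + y = y + y + y := this.trans h3.symm
        simpa using h4
      obtain ⟨r, hr, hr'⟩ := ih (x :: cur) (by simpa [hxC] using h) hT'
      refine ⟨r, ?_, hr'⟩
      simp only [srch, List.mem_flatMap]
      exact ⟨x, hxT, by simpa [hx, hok] using hr⟩

lemma cap_cons (x : V4) (cur : List V4) (hc : IsCap {y | y ∈ cur})
    (hok : okIns x cur = true) : IsCap {y | y ∈ x :: cur} := by
  simp only [okIns, List.all_eq_true, decide_eq_true_eq] at hok
  have key : ∀ b ∈ cur, ∀ c ∈ cur, x + b + c ≠ 0 := by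
    intro b hb c hc e
    apply hok b hb
    have : -(x + b) = c := by rw [neg_eq_iff_add_eq_zero]; exact e
    rwa [this]
  intro a ha b hb c hcc hab hac hbc
  simp only [Set.mem_ofPred_eq, List.mem_cons] at ha hb hcc
  rcases ha with rfl | ha <;> rcases hb with rfl | hb <;> rcases hcc with rfl | hcc
  · exact absurd rfl hab
  · exact absurd rfl hab
  · exact absurd rfl hac
  · exact key b hb c hcc
  · exact absurd rfl hbc
  · rw [add_comm a]; exact key a ha c hcc
  · rw [add_comm, ← add_assoc]; exact key a ha b hb
  · exact hc a ha b hb c hcc hab hac hbc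

lemma srch_sound (Ts : List (List V4)) :
    ∀ cur r : List V4, IsCap {y | y ∈ cur} → r ∈ srch Ts cur →
      IsCap {y | y ∈ r} ∧ ∀ y ∈ cur, y ∈ r := by
  induction Ts with
  | nil =>
    intro cur r h hr
    simp only [srch, List.mem_singleton] at hr
    subst hr
    exact ⟨h, fun _ h => h⟩
  | cons T Ts ih =>
    intro cur r h hr
    simp only [srch, List.mem_flatMap] at hr
    obtain ⟨x, hxT, hr⟩ := hr
    split_ifs at hr with h1 h2
    · exact ih cur r h hr
    · obtain ⟨h3, h4⟩ := ih (x :: cur) r (cap_cons x cur h h2) hr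
      exact ⟨h3, fun y hy => h4 y (by simp [hy])⟩
    · simp at hr

/-- The six maximal caps containing the canonical demicap, as lists. -/
def six : List (List V4) := srch triList demiList

lemma six_facts : six.length = 6 ∧ (∀ r ∈ six, r.length = 20 ∧ r.Nodup) ∧
    six.Pairwise (fun r s => ∃ x ∈ r, x ∉ s) := by
  decide +kernel

lemma demi_cap : IsCap {y | y ∈ demiList} := by
  have h : ∀ a ∈ demiList, ∀ b ∈ demiList, ∀ c ∈ demiList,
    a ≠ b → a ≠ c → b ≠ c → a + b + c ≠ 0 := by decide +kernel
  exact h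

lemma point_cases : ∀ x : V4, x ∈ demiList ∨ x ∈ restList ∨
    ∃ y ∈ demiList, ∃ z ∈ demiList, y ≠ z ∧ x + y + z = 0 := by
  decide +kernel

lemma demi_nodup : demiList.Nodup := by decide +kernel

lemma tri_two : ∀ x ∈ restList,
    ((Finset.univ : Finset (Fin triList.length)).filter
      (fun i => x ∈ triList.get i)).card = 2 := by
  decide +kernel

lemma tri_pair : ∀ T ∈ triList, ∀ x ∈ T, ∀ y ∈ T, x ≠ y →
    ∃ z ∈ demiList, z ≠ x ∧ z ≠ y ∧ x + y + z = 0 := by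
  decide +kernel

lemma meets_tri (C : Finset V4) (hC : IsCap (↑C : Set V4)) (hcard : C.card = 20)
    (hD : demiList.toFinset ⊆ C) : ∀ T ∈ triList, ∃ x ∈ T, x ∈ (↑C : Set V4) := by
  have hDC : ∀ y ∈ demiList, y ∈ C := fun y hy => hD (by simpa using hy)
  set E := C \ demiList.toFinset with hE
  have hEcard : E.card = 10 := by
    rw [hE, Finset.card_sdiff_of_subset hD, hcard, List.toFinset_card_of_nodup demi_nodup]
    rfl
  have hER : ∀ x ∈ E, x ∈ restList := by
    intro x hx
    rw [hE, Finset.mem_sdiff, List.mem_toFinset] at hx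
    rcases point_cases x with h | h | ⟨y, hy, z, hz, hyz, h⟩
    · exact absurd h hx.2
    · exact h
    · exact absurd h (hC x hx.1 y (hDC y hy) z (hDC z hz)
        (fun e => hx.2 (e ▸ hy)) (fun e => hx.2 (e ▸ hz)) hyz)
  have hsum := Finset.sum_card_bipartiteAbove_eq_sum_card_bipartiteBelow
    (s := E) (t := (Finset.univ : Finset (Fin triList.length)))
    (fun x i => x ∈ triList.get i)
  have h1 : ∑ x ∈ E, (Finset.bipartiteAbove (fun x i => x ∈ triList.get i)
      (Finset.univ : Finset (Fin triList.length)) x).card = 20 := by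
    exact (Finset.sum_congr rfl (fun x hx => tri_two x (hER x hx))).trans (by simp [hEcard])
  have hle : ∀ i ∈ (Finset.univ : Finset (Fin triList.length)),
      (Finset.bipartiteBelow (fun x i => x ∈ triList.get i) E i).card ≤ 1 := by
    intro i _
    rw [Finset.card_le_one]
    intro x hx y hy
    rw [Finset.mem_bipartiteBelow] at hx hy
    by_contra hxy
    obtain ⟨z, hz, hzx, hzy, h0⟩ := tri_pair _ (List.get_mem triList i) x hx.2 y hy.2 hxy
    exact hC x (Finset.sdiff_subset hx.1) y (Finset.sdiff_subset hy.1) z (hDC z hz) hxy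
      hzx.symm hzy.symm h0
  have heq : ∑ i : Fin triList.length,
      (Finset.bipartiteBelow (fun x i => x ∈ triList.get i) E i).card
      = ∑ i : Fin triList.length, 1 := by
    rw [← hsum, h1]; rfl
  have hall := (Finset.sum_eq_sum_iff_of_le hle).1 heq
  intro T hT
  obtain ⟨i, rfl⟩ := List.get_of_mem hT
  have h3 := hall i (Finset.mem_univ i)
  obtain ⟨x, hx⟩ := Finset.card_pos.1 (by rw [h3]; exact one_pos)
  rw [Finset.mem_bipartiteBelow] at hx
  exact ⟨x, hx.2, Finset.sdiff_subset hx.1⟩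

lemma canonical_six :
    {C : Finset V4 | IsCap (↑C : Set V4) ∧ C.card = 20 ∧ demiList.toFinset ⊆ C}.ncard = 6 := by
  obtain ⟨hlen, hr, hpw⟩ := six_facts
  have hset : {C : Finset V4 | IsCap (↑C : Set V4) ∧ C.card = 20 ∧ demiList.toFinset ⊆ C}
      = ↑((six.map List.toFinset).toFinset) := by
    ext C
    simp only [Set.mem_ofPred_eq, List.coe_toFinset, List.mem_map]
    constructor
    · rintro ⟨hC, hcard, hD⟩
      obtain ⟨r, hrs, hrC⟩ := srch_complete (↑C : Set V4) hC triList demiList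
        (fun y hy => hD (by simpa using hy)) (meets_tri C hC hcard hD)
      refine ⟨r, hrs, ?_⟩
      apply Finset.eq_of_subset_of_card_le
      · intro y hy
        exact hrC y (by simpa using hy)
      · rw [hcard, List.toFinset_card_of_nodup (hr r hrs).2, (hr r hrs).1]
    · rintro ⟨r, hrs, rfl⟩
      obtain ⟨h1, h2⟩ := srch_sound triList demiList r demi_cap hrs
      refine ⟨?_, ?_, ?_⟩
      · rw [List.coe_toFinset]; exact h1
      · rw [List.toFinset_card_of_nodup (hr r hrs).2, (hr r hrs).1]
      · intro y hy
        rw [List.mem_toFinset] at hy ⊢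
        exact h2 y hy
  rw [hset, Set.ncard_coe_finset, List.toFinset_card_of_nodup, List.length_map, hlen]
  rw [List.Nodup, List.pairwise_map]
  refine hpw.imp ?_
  rintro r s ⟨x, hx, hxs⟩ e
  apply hxs
  rw [← List.mem_toFinset, ← e, List.mem_toFinset]
  exact hx

lemma transport (T : V4 ≃ₗ[ZMod 3] V4) (a : V4) (D D₀ : Finset V4)
    (hD : ∀ y, y ∈ D ↔ ∃ x ∈ D₀, T x + a = y) :
    {C : Finset V4 | IsCap (↑C : Set V4) ∧ C.card = 20 ∧ D ⊆ C}.ncard =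
    {C : Finset V4 | IsCap (↑C : Set V4) ∧ C.card = 20 ∧ D₀ ⊆ C}.ncard := by
  let φ : V4 ≃ V4 := T.toEquiv.trans (Equiv.addRight a)
  have hφ : ∀ x, φ x = T x + a := fun x => rfl
  have hsum : ∀ x y z, φ x + φ y + φ z = 0 ↔ x + y + z = 0 := by
    intro x y z
    have : φ x + φ y + φ z = T (x + y + z) := by
      rw [hφ, hφ, hφ, map_add, map_add]
      have h3 := v4_three a
      calc _ = T x + T y + T z + (a + a + a) := by abel
        _ = _ := by rw [h3, add_zero]
    rw [this, map_eq_zero_iff _ T.injective]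
  have hDm : D = D₀.map φ.toEmbedding := by
    ext y
    rw [hD, Finset.mem_map]
    rfl
  have hcap : ∀ C : Finset V4, IsCap (↑(C.map φ.toEmbedding) : Set V4) ↔ IsCap (↑C : Set V4) := by
    intro C
    constructor
    · intro h x hx y hy z hz hxy hxz hyz h0
      exact h (φ x) (by simpa using hx) (φ y) (by simpa using hy) (φ z) (by simpa using hz)
        (by simpa using hxy) (by simpa using hxz) (by simpa using hyz) ((hsum x y z).2 h0)
    · intro h x hx y hy z hz hxy hxz hyz h0
      rw [Finset.mem_coe, Finset.mem_map] at hx hy hz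
      obtain ⟨x, hx, rfl⟩ := hx
      obtain ⟨y, hy, rfl⟩ := hy
      obtain ⟨z, hz, rfl⟩ := hz
      exact h x hx y hy z hz (fun e => hxy (by rw [e])) (fun e => hxz (by rw [e]))
        (fun e => hyz (by rw [e])) ((hsum x y z).1 h0)
  symm
  rw [← Set.ncard_image_of_injective _ (Finset.map_injective φ.toEmbedding)]
  symm
  congr 1
  ext C
  simp only [Set.mem_image, Set.mem_ofPred_eq]
  constructor
  · rintro ⟨h1, h2, h3⟩
    have hC : (C.map φ.symm.toEmbedding).map φ.toEmbedding = C := by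
      ext y; simp
    refine ⟨C.map φ.symm.toEmbedding, ⟨?_, ?_, ?_⟩, hC⟩
    · rw [← hcap, hC]; exact h1
    · rw [Finset.card_map, h2]
    · rw [← Finset.map_subset_map (f := φ.toEmbedding), hC, ← hDm]; exact h3
  · rintro ⟨C, ⟨h1, h2, h3⟩, rfl⟩
    refine ⟨(hcap C).2 h1, by rw [Finset.card_map, h2], ?_⟩
    rw [hDm, Finset.map_subset_map]; exact h3

lemma demi_mem (x : V4) : x ∈ demiList ↔
    (∃ i : Fin 4, x = Pi.single i 1 ∨ x = -Pi.single i 1) ∨ x = (fun _ => 1) ∨ x = -(fun _ => 1) := by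
  revert x
  decide +kernel

/-- Four vectors `v 0, …, v 3` no hyperplane contains four of the five. -/
lemma exists_coord (v : Fin 5 → V4)
    (hv : ∀ f : Module.Dual (ZMod 3) V4, f ≠ 0 → ∀ j : Fin 5, ∃ i, i ≠ j ∧ f (v i) ≠ 0) :
    ∃ T : V4 ≃ₗ[ZMod 3] V4,
      (∀ i : Fin 4, T (Pi.single i 1) = v i.castSucc ∨ T (Pi.single i 1) = -v i.castSucc) ∧
      T (fun _ => 1) = v (Fin.last 4) := by
  have hspan : ⊤ ≤ Submodule.span (ZMod 3) (Set.range fun i : Fin 4 => v i.castSucc) := by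
    by_contra hlt
    rw [top_le_iff] at hlt
    obtain ⟨f, hf, hle⟩ := Submodule.exists_le_ker_of_lt_top _ (lt_top_iff_ne_top.2 hlt)
    obtain ⟨i, hi, hfi⟩ := hv f hf (Fin.last 4)
    obtain ⟨k, rfl⟩ := Fin.exists_castSucc_eq.2 hi
    exact hfi (hle (Submodule.subset_span ⟨k, rfl⟩))
  have hli : LinearIndependent (ZMod 3) (fun i : Fin 4 => v i.castSucc) :=
    linearIndependent_of_top_le_span_of_card_eq_finrank hspan (by simp)
  let b := Module.Basis.mk hli hspan
  have hb : ∀ i, b i = v i.castSucc := fun i => by simp [b]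
  let c := b.repr (v (Fin.last 4))
  have hc : ∀ i, c i ≠ 0 := by
    intro i hi
    have hne : b.coord i ≠ 0 := by
      intro h
      have : b.coord i (b i) = 1 := by simp
      rw [h] at this
      simp at this
    obtain ⟨k, hk, hfk⟩ := hv (b.coord i) hne i.castSucc
    rcases Fin.eq_castSucc_or_eq_last k with ⟨k, rfl⟩ | rfl
    · apply hfk
      rw [← hb, Module.Basis.coord_apply, Module.Basis.repr_self, Finsupp.single_apply,
        if_neg]
      rintro rfl
      exact hk rfl
    · exact hfk hi
  let w : Fin 4 → (ZMod 3)ˣ := fun i => Units.mk0 (c i) (hc i)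
  let b' := b.unitsSMul w
  have hb' : ∀ i, b' i = c i • v i.castSucc := by
    intro i
    rw [Module.Basis.unitsSMul_apply, hb]
    rfl
  have hT : ∀ x, b'.equivFun.symm x = ∑ i, x i • b' i := fun x => b'.equivFun_symm_apply x
  refine ⟨b'.equivFun.symm, ?_, ?_⟩
  · intro i
    have h1 : b'.equivFun.symm (Pi.single i 1) = c i • v i.castSucc := by
      rw [hT, ← hb', Finset.sum_eq_single i]
      · simp
      · intro j _ hj
        simp [hj]
      · simp
    rw [h1]
    have : ∀ t : ZMod 3, t ≠ 0 → t = 1 ∨ t = -1 := by decide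
    rcases this (c i) (hc i) with h | h
    · left; rw [h, one_smul]
    · right; rw [h, neg_smul, one_smul]
  · rw [hT]
    have := b.sum_repr (v (Fin.last 4))
    rw [← this]
    refine Finset.sum_congr rfl fun i _ => ?_
    rw [one_smul, hb', hb]

theorem demicap_in_six_maxcaps (a : V4) (D : Finset V4) (h : IsDemicap a D) :
    {C : Finset V4 | IsCap (↑C : Set V4) ∧ C.card = 20 ∧ D ⊆ C}.ncard = 6 := by
  obtain ⟨-, -, d, d', hdd, hD, hW⟩ := h
  have hd' : ∀ i, d' i = -(d i - a) + a := by
    intro i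
    have h3 := v4_three a
    have h4 : a + d i + d' i = a + a + a := (hdd i).trans h3.symm
    have h5 : d' i = a + a + a - (a + d i) := by rw [← h4]; abel
    rw [h5]; abel
  have hv : ∀ f : Module.Dual (ZMod 3) V4, f ≠ 0 → ∀ j : Fin 5,
      ∃ i, i ≠ j ∧ f (d i - a) ≠ 0 := by
    intro f hf j
    by_contra hcon
    push Not at hcon
    apply hW
    refine ⟨Finset.univ.erase j, by simp, LinearMap.ker f, ?_, ?_⟩
    · have := Module.Dual.finrank_ker_add_one_of_ne_zero hf
      simp at this
      omega
    · intro i hi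
      exact hcon i (Finset.ne_of_mem_erase hi)
  obtain ⟨T, hT, hT1⟩ := exists_coord (fun i => d i - a) hv
  rw [transport T a D demiList.toFinset, canonical_six]
  intro y
  have hy : y ∈ D ↔ ∃ i : Fin 5, d i - a + a = y ∨ -(d i - a) + a = y := by
    rw [hD, Finset.mem_union, Finset.mem_image, Finset.mem_image]
    simp [hd', exists_or]
  rw [hy]
  constructor
  · rintro ⟨i, hi⟩
    rcases Fin.eq_castSucc_or_eq_last i with ⟨k, rfl⟩ | rfl
    · rcases hT k with h | h <;> rcases hi with rfl | rfl
      · exact ⟨Pi.single k 1, by rw [List.mem_toFinset, demi_mem]; exact Or.inl ⟨k, Or.inl rfl⟩,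
          by rw [h]⟩
      · exact ⟨-Pi.single k 1, by rw [List.mem_toFinset, demi_mem]; exact Or.inl ⟨k, Or.inr rfl⟩,
          by rw [map_neg, h]⟩
      · exact ⟨-Pi.single k 1, by rw [List.mem_toFinset, demi_mem]; exact Or.inl ⟨k, Or.inr rfl⟩,
          by rw [map_neg, h, neg_neg]⟩
      · exact ⟨Pi.single k 1, by rw [List.mem_toFinset, demi_mem]; exact Or.inl ⟨k, Or.inl rfl⟩,
          by rw [h]⟩
    · rcases hi with rfl | rfl
      · exact ⟨fun _ => 1, by rw [List.mem_toFinset, demi_mem]; exact Or.inr (Or.inl rfl),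
          by rw [hT1]⟩
      · exact ⟨-(fun _ => 1), by rw [List.mem_toFinset, demi_mem]; exact Or.inr (Or.inr rfl),
          by rw [map_neg, hT1]⟩
  · rintro ⟨x, hx, rfl⟩
    rw [List.mem_toFinset, demi_mem] at hx
    rcases hx with ⟨k, rfl | rfl⟩ | rfl | rfl
    · rcases hT k with h | h
      · exact ⟨k.castSucc, Or.inl (by rw [h])⟩
      · exact ⟨k.castSucc, Or.inr (by rw [h])⟩
    · rcases hT k with h | h
      · exact ⟨k.castSucc, Or.inr (by rw [map_neg, h])⟩
      · exact ⟨k.castSucc, Or.inl (by rw [map_neg, h, neg_neg])⟩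
    · exact ⟨Fin.last 4, Or.inl (by rw [hT1])⟩
    · exact ⟨Fin.last 4, Or.inr (by rw [map_neg, hT1])⟩
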